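/- Let α ∈ (0,1) and let r satisfy 1 ≤ r ≤ (2−α)/α. Let the temporal mesh be quasi-graded with parameter r and constants c_0 ≤ C_0. Then there exists a constant C > 0, depending only on α, γ, r, T, c_0, C_0, such that: for every γ ∈ ℝ and every real sequence V^0,...,V^M with V^0 = 0 and δ_t^α W^j ≤ (τ/t_j)^{γ+1} for all j = 1,...,M, where W^j := |V^j|, one has |V^j| ≤ C 𝒱^j for all j = 1,...,M. -/

import Mathlib

open Real MeasureTheory Set

/-- The L1 discrete fractional-derivative operator associated with the mesh `t`,
applied to the sequence `V`, at time level `m`. -/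
noncomputable def deltaL1 (α : ℝ) (t : ℕ → ℝ) (V : ℕ → ℝ) (m : ℕ) : ℝ :=
  (1 / Real.Gamma (1 - α)) *
    ∑ j ∈ Finset.Icc 1 m,
      ((V j - V (j - 1)) / (t j - t (j - 1))) *
        ∫ s in (t (j - 1))..(t j), (t m - s) ^ (-α)

/-- `t 0 = 0 < t 1 < ... < t M = T` with `M ≥ 2`. -/
def IsMesh (T : ℝ) (M : ℕ) (t : ℕ → ℝ) : Prop :=
  2 ≤ M ∧ t 0 = 0 ∧ (∀ j, j < M → t j < t (j + 1)) ∧ t M = T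

/-- Quasi-graded mesh with parameter `r` and constants `c0 ≤ C0`. -/
def QuasiGraded (r c0 C0 : ℝ) (M : ℕ) (t : ℕ → ℝ) : Prop :=
  (c0 * (M : ℝ) ^ (-r) ≤ t 1 ∧ t 1 ≤ C0 * (M : ℝ) ^ (-r)) ∧
  (∀ j : ℕ, 1 ≤ j → j ≤ M →
    c0 * (t 1 * (j : ℝ) ^ r) ≤ t j ∧ t j ≤ C0 * (t 1 * (j : ℝ) ^ r)) ∧
  (∀ j : ℕ, 1 ≤ j → j ≤ M →
    c0 * ((t 1) ^ (1 / r) * (t j) ^ (1 - 1 / r)) ≤ t j - t (j - 1) ∧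
    t j - t (j - 1) ≤ C0 * ((t 1) ^ (1 / r) * (t j) ^ (1 - 1 / r)))

/-- The stability majorant `𝒱^j`. -/
noncomputable def Vcal (α γ τ tj : ℝ) : ℝ :=
  if 0 < γ then τ * tj ^ (α - 1)
  else if γ = 0 then τ * tj ^ (α - 1) * (1 + Real.log (tj / τ))
  else τ * tj ^ (α - 1) * (τ / tj) ^ γ

lemma rpow_slope {p y z : ℝ} (hz : 0 < z ∨ (0 ≤ z ∧ 0 < p)) (hzy : z < y) :
    ∃ c ∈ Ioo z y, y ^ p - z ^ p = p * c ^ (p - 1) * (y - z) := by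
  have hz0 : 0 ≤ z := hz.elim le_of_lt And.left
  obtain ⟨c, hc, h⟩ := exists_hasDerivAt_eq_slope (fun s : ℝ => s ^ p)
    (fun s => p * s ^ (p - 1)) hzy
    (fun s hs => by
      refine (Real.continuousAt_rpow_const s p ?_).continuousWithinAt
      rcases hz with h | h
      · exact Or.inl (h.trans_le hs.1).ne'
      · exact Or.inr h.2.le)
    (fun s hs => Real.hasDerivAt_rpow_const (Or.inl (hz0.trans_lt hs.1).ne'))
  refine ⟨c, hc, ?_⟩
  have : y - z ≠ 0 := (sub_pos.2 hzy).ne'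
  rw [h]
  field_simp

/-- The primitive of `s ↦ (x - s) ^ (-α)` vanishing at `s = x`. -/
noncomputable def kernelPrim (α x s : ℝ) : ℝ := -((x - s) ^ (1 - α) / (1 - α))

lemma integral_kernel {α a b x : ℝ} (hα : α < 1) :
    ∫ s in a..b, (x - s) ^ (-α) = kernelPrim α x b - kernelPrim α x a := by
  rw [intervalIntegral.integral_comp_sub_left (fun s : ℝ => s ^ (-α)) x,
    integral_rpow (Or.inl (by linarith))]
  simp only [kernelPrim, show -α + 1 = 1 - α by ring]
  ring

lemma kernelPrim_slope {α a b x : ℝ} (hα : α < 1) (hab : a < b) (hbx : b ≤ x) :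
    ∃ c ∈ Ioo a b, kernelPrim α x b - kernelPrim α x a = (x - c) ^ (-α) * (b - a) := by
  obtain ⟨c, hc, h⟩ := rpow_slope (p := 1 - α) (z := x - b) (y := x - a)
    (Or.inr ⟨by linarith, by linarith⟩) (by linarith)
  refine ⟨x - c, ⟨by linarith [hc.2], by linarith [hc.1]⟩, ?_⟩
  have h1 : 1 - α ≠ 0 := by linarith
  rw [show 1 - α - 1 = -α by ring] at h
  rw [show x - (x - c) = c by ring]
  simp only [kernelPrim]
  field_simp
  linarith

lemma kernel_le_kernel {α a b x : ℝ} (hα : 0 < α) (hab : a ≤ b) (hbx : b < x) :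
    (x - a) ^ (-α) ≤ (x - b) ^ (-α) :=
  Real.rpow_le_rpow_of_nonpos (by linarith) (by linarith) (by linarith)

lemma kernel_mul_le_kernelPrim {α a b x : ℝ} (hα0 : 0 < α) (hα1 : α < 1) (hab : a < b)
    (hbx : b ≤ x) :
    (x - a) ^ (-α) * (b - a) ≤ kernelPrim α x b - kernelPrim α x a := by
  obtain ⟨c, hc, h⟩ := kernelPrim_slope hα1 hab hbx
  rw [h]
  exact mul_le_mul_of_nonneg_right (kernel_le_kernel hα0 hc.1.le (hc.2.trans_le hbx))
    (by linarith)

lemma kernelPrim_le_kernel_mul {α a b x : ℝ} (hα0 : 0 < α) (hα1 : α < 1) (hab : a < b)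
    (hbx : b < x) :
    kernelPrim α x b - kernelPrim α x a ≤ (x - b) ^ (-α) * (b - a) := by
  obtain ⟨c, hc, h⟩ := kernelPrim_slope hα1 hab hbx.le
  rw [h]
  exact mul_le_mul_of_nonneg_right (kernel_le_kernel hα0 hc.2.le hbx) (by linarith)

lemma hasDerivAt_kernelPrim {α x s : ℝ} (hα : α < 1) (hs : s < x) :
    HasDerivAt (kernelPrim α x) ((x - s) ^ (-α)) s := by
  have h1 : 1 - α ≠ 0 := by linarith
  have h := ((((hasDerivAt_id s).const_sub x).rpow_const (p := 1 - α)
    (Or.inl (by simp only [id]; linarith))).div_const (1 - α)).neg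
  refine h.congr_deriv ?_
  simp only [id, show 1 - α - 1 = -α by ring]
  field_simp

lemma continuous_kernelPrim {α x : ℝ} (hα : α < 1) : Continuous (kernelPrim α x) := by
  unfold kernelPrim
  exact (((continuous_const.sub continuous_id).rpow_const
    (fun _ => Or.inr (by linarith))).div_const _).neg

/-- A primitive of `s ↦ (α - 1) s ^ (α - 2) (x - s) ^ (-α)`. -/
noncomputable def powKernelPrim (α x s : ℝ) : ℝ := (x - s) ^ (1 - α) * s ^ (α - 1) / x

lemma hasDerivAt_powKernelPrim {α x s : ℝ} (hs0 : 0 < s) (hs : s < x) :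
    HasDerivAt (powKernelPrim α x) ((α - 1) * s ^ (α - 2) * (x - s) ^ (-α)) s := by
  have h := ((((hasDerivAt_id s).const_sub x).rpow_const (p := 1 - α)
    (Or.inl (by simp only [id]; linarith))).mul
      (Real.hasDerivAt_rpow_const (p := α - 1) (Or.inl hs0.ne'))).div_const x
  refine h.congr_deriv ?_
  have hx : x ≠ 0 := (hs0.trans hs).ne'
  have hxs : 0 < x - s := by linarith
  simp only [id]
  rw [show 1 - α - 1 = -α by ring, show α - 1 - 1 = α - 2 by ring,
    show 1 - α = -α + 1 by ring, show α - 1 = α - 2 + 1 by ring, Real.rpow_add_one hxs.ne',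
    Real.rpow_add_one hs0.ne']
  field_simp
  ring

/-- Chord slope against the kernel versus the exact integral, for the convex function
`s ^ (α - 1)`. -/
lemma powKernelPrim_sub_le {α a b x : ℝ} (hα0 : 0 < α) (hα1 : α < 1) (ha : 0 < a) (hab : a < b)
    (hbx : b ≤ x) :
    powKernelPrim α x b - powKernelPrim α x a -
        (1 - α) * (a ^ (α - 2) - b ^ (α - 2)) *
          (kernelPrim α x b - kernelPrim α x a - (x - a) ^ (-α) * (b - a)) ≤
      (b ^ (α - 1) - a ^ (α - 1)) / (b - a) * (kernelPrim α x b - kernelPrim α x a) := by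
  have hb : 0 < b := ha.trans hab
  have hba : b - a ≠ 0 := by linarith
  set κ := (x - a) ^ (-α) with hκ
  set A := (b ^ (α - 1) - a ^ (α - 1)) / (b - a) with hA
  set D := (1 - α) * (a ^ (α - 2) - b ^ (α - 2)) with hD
  have hslope : (α - 1) * a ^ (α - 2) ≤ A := by
    obtain ⟨c, hc, h⟩ := rpow_slope (p := α - 1) (Or.inl ha) hab
    rw [hA, h, mul_div_assoc, div_self hba, mul_one, show α - 1 - 1 = α - 2 by ring]
    have : c ^ (α - 2) ≤ a ^ (α - 2) :=
      Real.rpow_le_rpow_of_nonpos ha hc.1.le (by linarith)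
    nlinarith
  have key : AntitoneOn (fun s => powKernelPrim α x s - κ * s ^ (α - 1) -
      (A + D) * (kernelPrim α x s - κ * s)) (Icc a b) := by
    have hder : ∀ s ∈ Ioo a b, HasDerivAt (fun s => powKernelPrim α x s - κ * s ^ (α - 1) -
        (A + D) * (kernelPrim α x s - κ * s))
        (((α - 1) * s ^ (α - 2) - (A + D)) * ((x - s) ^ (-α) - κ)) s := by
      intro s hs
      have hs0 : 0 < s := ha.trans hs.1
      have hsx : s < x := hs.2.trans_le hbx
      have h := ((hasDerivAt_powKernelPrim (α := α) hs0 hsx).sub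
        ((Real.hasDerivAt_rpow_const (p := α - 1) (Or.inl hs0.ne')).const_mul κ)).sub
        (((hasDerivAt_kernelPrim hα1 hsx).sub ((hasDerivAt_id s).const_mul κ)).const_mul (A + D))
      refine h.congr_deriv ?_
      rw [show α - 1 - 1 = α - 2 by ring]
      ring
    refine antitoneOn_of_deriv_nonpos (convex_Icc a b) ?_ ?_ ?_
    · have hpow : ContinuousOn (fun s : ℝ => s ^ (α - 1)) (Icc a b) := fun s hs =>
        (Real.continuousAt_rpow_const s _
          (Or.inl (ha.trans_le hs.1).ne')).continuousWithinAt
      have hK := (continuous_kernelPrim (x := x) hα1).continuousOn (s := Icc a b)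
      have hP : ContinuousOn (powKernelPrim α x) (Icc a b) := by
        unfold powKernelPrim
        exact ((((continuous_const.sub continuous_id).rpow_const
          (fun _ => Or.inr (by linarith))).continuousOn).mul hpow).div_const _
      exact (hP.sub (hpow.const_mul κ)).sub
        ((hK.sub (continuousOn_id.const_mul κ)).const_mul (A + D))
    · intro s hs
      rw [interior_Icc] at hs
      exact (hder s hs).differentiableAt.differentiableWithinAt
    · intro s hs
      rw [interior_Icc] at hs
      rw [(hder s hs).deriv]
      have h1 : κ ≤ (x - s) ^ (-α) := kernel_le_kernel hα0 hs.1.le (hs.2.trans_le hbx)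
      have h2 : b ^ (α - 2) ≤ s ^ (α - 2) :=
        Real.rpow_le_rpow_of_nonpos (ha.trans hs.1) hs.2.le (by linarith)
      refine mul_nonpos_of_nonpos_of_nonneg ?_ (by linarith)
      rw [hD]
      nlinarith
  have h := key (left_mem_Icc.2 hab.le) (right_mem_Icc.2 hab.le) hab.le
  have hAe : A * (b - a) = b ^ (α - 1) - a ^ (α - 1) := by rw [hA]; field_simp
  simp only at h
  linear_combination h - κ * hAe

/-- The margin gained by truncating `s ^ (α - 1)` on `[0, u]`. -/
lemma margin_le {α u x : ℝ} (hα0 : 0 < α) (hα1 : α < 1) (hu : 0 < u) (hux : u ≤ x) :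
    (1 - α) * u ^ α * x ^ (-α - 1) ≤ u ^ (α - 1) * x ^ (-α) - powKernelPrim α x u := by
  have hx : 0 < x := hu.trans_le hux
  have hb := rpow_one_add_le_one_add_mul_self (s := -(u / x)) (p := 1 - α)
    (by rw [neg_le_neg_iff, div_le_one hx]; exact hux) (by linarith) (by linarith)
  have h1 : (x - u) ^ (1 - α) = x ^ (1 - α) * (1 + -(u / x)) ^ (1 - α) := by
    rw [← Real.mul_rpow hx.le]
    · congr 1
      field_simp
      ring
    · have : u / x ≤ 1 := (div_le_one hx).2 hux
      linarith
  have h2 : x ^ (1 - α) = x ^ (-α) * x := by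
    rw [show 1 - α = -α + 1 by ring, Real.rpow_add_one hx.ne']
  have h3 : x ^ (-α) = x ^ (-α - 1) * x := by
    rw [← Real.rpow_add_one hx.ne']; ring_nf
  have h4 : u ^ α = u ^ (α - 1) * u := by
    rw [← Real.rpow_add_one hu.ne']; ring_nf
  unfold powKernelPrim
  rw [h1, h2, h3, h4]
  have hpos : 0 < u ^ (α - 1) * x ^ (-α - 1) * x := by positivity
  have := mul_le_mul_of_nonneg_left hb hpos.le
  have e : x ^ (-α - 1) * x * x * (1 + -(u / x)) ^ (1 - α) * u ^ (α - 1) / x =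
      u ^ (α - 1) * x ^ (-α - 1) * x * (1 + -(u / x)) ^ (1 - α) := by field_simp
  rw [e]
  have e2 : u ^ (α - 1) * x ^ (-α - 1) * x * (1 + (1 - α) * -(u / x)) =
      u ^ (α - 1) * x ^ (-α - 1) * x - (1 - α) * (u ^ (α - 1) * u) * x ^ (-α - 1) := by
    field_simp
    ring
  linarith

/-- Defect of the left-endpoint rule for the kernel is controlled by a telescoping shift. -/
lemma kernel_defect_le_shift {α a b x L : ℝ} (hα0 : 0 < α) (hα1 : α < 1) (hab : a < b)
    (hbx : b ≤ x) (hL : b - a ≤ L) :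
    kernelPrim α x b - kernelPrim α x a - (x - a) ^ (-α) * (b - a) ≤
      (kernelPrim α x b - kernelPrim α x (b - L)) -
        (kernelPrim α x a - kernelPrim α x (a - L)) := by
  obtain ⟨c, hc, h⟩ := kernelPrim_slope (x := x) hα1 (sub_lt_sub_right hab L) (by linarith)
  have h1 : (x - c) ^ (-α) ≤ (x - a) ^ (-α) :=
    kernel_le_kernel hα0 (by linarith [hc.2]) (by linarith)
  have h2 := mul_le_mul_of_nonneg_right h1 (sub_nonneg.2 hab.le)
  rw [show b - L - (a - L) = b - a by ring] at h
  linarith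

lemma rpow_half_le {p x : ℝ} (n : ℕ) (hp : -(n : ℝ) ≤ p) (hx : 0 < x) :
    (x / 2) ^ p ≤ 2 ^ n * x ^ p := by
  rw [Real.div_rpow hx.le (by norm_num), div_eq_mul_inv, mul_comm, ← Real.rpow_neg (by norm_num)]
  refine mul_le_mul_of_nonneg_right ?_ (by positivity)
  rw [← Real.rpow_natCast]
  exact Real.rpow_le_rpow_of_exponent_le (by norm_num) (by linarith)

lemma kernel_defect_le_sq {α a b x : ℝ} (hα0 : 0 < α) (hα1 : α < 1) (hab : a < b)
    (hx : 0 < x) (hbx : b ≤ x / 2) :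
    kernelPrim α x b - kernelPrim α x a - (x - a) ^ (-α) * (b - a) ≤
      4 * x ^ (-α - 1) * (b - a) ^ 2 := by
  have h1 := kernelPrim_le_kernel_mul (x := x) hα0 hα1 hab (by linarith)
  obtain ⟨c, hc, h⟩ := rpow_slope (p := -α) (z := x - b) (y := x - a)
    (Or.inl (by linarith)) (by linarith)
  have h2 : c ^ (-α - 1) ≤ (x / 2) ^ (-α - 1) :=
    Real.rpow_le_rpow_of_nonpos (by linarith) (by linarith [hc.1]) (by linarith)
  have h3 : (x / 2) ^ (-α - 1) ≤ 4 * x ^ (-α - 1) := by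
    have := rpow_half_le (p := -α - 1) 2 (by push_cast; linarith) hx
    norm_num at this
    exact this
  have h4 : 0 ≤ c ^ (-α - 1) := Real.rpow_nonneg (by linarith [hc.1]) _
  have h5 : α * c ^ (-α - 1) ≤ 4 * x ^ (-α - 1) := by nlinarith
  have h6 : (x - b) ^ (-α) - (x - a) ^ (-α) ≤ 4 * x ^ (-α - 1) * (b - a) := by
    have := mul_le_mul_of_nonneg_right h5 (sub_nonneg.2 hab.le)
    rw [show x - a - (x - b) = b - a by ring] at h
    linarith
  have := mul_le_mul_of_nonneg_right h6 (sub_nonneg.2 hab.le)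
  nlinarith

/-- Local truncation error on one mesh interval, bounded by two telescoping contributions. -/
lemma truncation_le {α a b x τ ρ C₀ L : ℝ} (hα0 : 0 < α) (hα1 : α < 1) (ha : 0 < a)
    (hab : a < b) (hbx : b ≤ x) (hτ : 0 < τ) (hρ : 0 < ρ) (hρa : ρ * b ≤ a) (hC₀ : 0 < C₀)
    (hstep : b - a ≤ C₀ * (τ ^ (α / (2 - α)) * b ^ (1 - α / (2 - α))))
    (hL : L = C₀ * (τ ^ (α / (2 - α)) * x ^ (1 - α / (2 - α)))) :
    (1 - α) * (a ^ (α - 2) - b ^ (α - 2)) *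
        (kernelPrim α x b - kernelPrim α x a - (x - a) ^ (-α) * (b - a)) ≤
      16 * ρ ^ (α - 3) * L * x ^ (α - 3) *
        ((kernelPrim α x b - kernelPrim α x (b - L)) -
          (kernelPrim α x a - kernelPrim α x (a - L))) +
      8 * ρ ^ (α - 3) * C₀ ^ 2 * (τ ^ (α / (2 - α))) ^ 2 * x ^ (-α - 1) *
        ((a ^ (-(α * (α / (2 - α)))) - b ^ (-(α * (α / (2 - α))))) /
          (α * (α / (2 - α)))) := by
  set μ := α / (2 - α) with hμ
  have h2α : 0 < 2 - α := by linarith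
  have hμ0 : 0 < μ := by positivity
  have hμ1 : μ < 1 := by rw [hμ, div_lt_one h2α]; linarith
  have hμα : 2 * μ - α = α * μ := by rw [hμ]; field_simp; ring
  have hb : 0 < b := ha.trans hab
  have hx : 0 < x := hb.trans_le hbx
  have hd : 0 < b - a := by linarith
  set h := kernelPrim α x b - kernelPrim α x a - (x - a) ^ (-α) * (b - a) with hh
  have hh0 : 0 ≤ h := by
    have := kernel_mul_le_kernelPrim hα0 hα1 hab hbx
    linarith
  have hρ3 : 0 < ρ ^ (α - 3) := by positivity
  set D := (1 - α) * (a ^ (α - 2) - b ^ (α - 2)) with hD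
  have hD1 : D ≤ 2 * ρ ^ (α - 3) * (b - a) * b ^ (α - 3) := by
    obtain ⟨c, hc, hce⟩ := rpow_slope (p := α - 2) (Or.inl ha) hab
    rw [show α - 2 - 1 = α - 3 by ring] at hce
    have h1 : c ^ (α - 3) ≤ ρ ^ (α - 3) * b ^ (α - 3) := by
      rw [← Real.mul_rpow hρ.le hb.le]
      exact Real.rpow_le_rpow_of_nonpos (by positivity) (hρa.trans hc.1.le) (by linarith)
    have h2 : D = (1 - α) * (2 - α) * (c ^ (α - 3) * (b - a)) := by
      rw [hD]; linear_combination -(1 - α) * hce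
    have hc0 : 0 < c := ha.trans hc.1
    have h3 : 0 ≤ c ^ (α - 3) * (b - a) := by positivity
    have h4 : (1 - α) * (2 - α) ≤ 2 := by nlinarith
    calc D ≤ 2 * (c ^ (α - 3) * (b - a)) := by
          rw [h2]; exact mul_le_mul_of_nonneg_right h4 h3
      _ ≤ 2 * (ρ ^ (α - 3) * b ^ (α - 3) * (b - a)) := by gcongr
      _ = _ := by ring
  have hstepL : b - a ≤ L := by
    rw [hL]
    refine hstep.trans ?_
    have := Real.rpow_le_rpow hb.le hbx (show 0 ≤ 1 - μ by linarith)
    gcongr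
  have hshift := kernel_defect_le_shift hα0 hα1 hab hbx hstepL
  rw [← hh] at hshift
  have hL0 : 0 < L := hd.trans_le hstepL
  have hqpos : 0 < α * μ := by positivity
  have hfar : (b - a) * b ^ (-(α * μ) - 1) ≤
      (a ^ (-(α * μ)) - b ^ (-(α * μ))) / (α * μ) := by
    obtain ⟨c, hc, hce⟩ := rpow_slope (p := -(α * μ)) (Or.inl ha) hab
    have h1 : b ^ (-(α * μ) - 1) ≤ c ^ (-(α * μ) - 1) :=
      Real.rpow_le_rpow_of_nonpos (ha.trans hc.1) hc.2.le (by linarith)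
    have h2 : (a ^ (-(α * μ)) - b ^ (-(α * μ))) / (α * μ) = c ^ (-(α * μ) - 1) * (b - a) := by
      rw [div_eq_iff hqpos.ne']; linear_combination -hce
    rw [h2, mul_comm]
    gcongr
  have hfar0 : 0 ≤ (a ^ (-(α * μ)) - b ^ (-(α * μ))) / (α * μ) := le_trans (by positivity) hfar
  rcases le_or_gt b (x / 2) with hbx2 | hbx2
  · have h1 := kernel_defect_le_sq hα0 hα1 hab hx hbx2
    rw [← hh] at h1
    have h2 : D * h ≤ (2 * ρ ^ (α - 3) * (b - a) * b ^ (α - 3)) *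
        (4 * x ^ (-α - 1) * (b - a) ^ 2) :=
      mul_le_mul hD1 h1 hh0 (by positivity)
    have h3 : (b - a) ^ 2 ≤ (C₀ * (τ ^ μ * b ^ (1 - μ))) ^ 2 :=
      pow_le_pow_left₀ hd.le hstep 2
    have h4 : (b ^ (1 - μ)) ^ 2 * b ^ (α - 3) = b ^ (-(α * μ) - 1) := by
      rw [← Real.rpow_natCast, ← Real.rpow_mul hb.le, ← Real.rpow_add hb]
      congr 1
      push_cast
      linarith
    have h5 : 0 ≤ 16 * ρ ^ (α - 3) * L * x ^ (α - 3) *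
        ((kernelPrim α x b - kernelPrim α x (b - L)) -
          (kernelPrim α x a - kernelPrim α x (a - L))) :=
      mul_nonneg (by positivity) (hh0.trans hshift)
    calc D * h ≤ 8 * ρ ^ (α - 3) * x ^ (-α - 1) * (b - a) * b ^ (α - 3) * (b - a) ^ 2 := by
          linarith
      _ ≤ 8 * ρ ^ (α - 3) * x ^ (-α - 1) * (b - a) * b ^ (α - 3) *
          (C₀ * (τ ^ μ * b ^ (1 - μ))) ^ 2 := by gcongr
      _ = 8 * ρ ^ (α - 3) * C₀ ^ 2 * (τ ^ μ) ^ 2 * x ^ (-α - 1) *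
          ((b - a) * ((b ^ (1 - μ)) ^ 2 * b ^ (α - 3))) := by ring
      _ ≤ 8 * ρ ^ (α - 3) * C₀ ^ 2 * (τ ^ μ) ^ 2 * x ^ (-α - 1) *
          ((a ^ (-(α * μ)) - b ^ (-(α * μ))) / (α * μ)) := by
          rw [h4]; gcongr
      _ ≤ _ := le_add_of_nonneg_left h5
  · have h1 : b ^ (α - 3) ≤ 8 * x ^ (α - 3) := by
      refine (Real.rpow_le_rpow_of_nonpos (by linarith) hbx2.le (by linarith)).trans ?_
      have := rpow_half_le (p := α - 3) 3 (by push_cast; linarith) hx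
      norm_num at this
      exact this
    have h2 : D ≤ 16 * ρ ^ (α - 3) * L * x ^ (α - 3) := by
      calc D ≤ 2 * ρ ^ (α - 3) * (b - a) * b ^ (α - 3) := hD1
        _ ≤ 2 * ρ ^ (α - 3) * L * (8 * x ^ (α - 3)) := by gcongr
        _ = _ := by ring
    calc D * h ≤ 16 * ρ ^ (α - 3) * L * x ^ (α - 3) * _ :=
          mul_le_mul h2 hshift hh0 (by positivity)
      _ ≤ _ := le_add_of_nonneg_right (mul_nonneg (by positivity) hfar0)

/-- The average of the kernel `s ↦ (t m - s) ^ (-α)` over the `j`-th mesh interval. -/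
noncomputable def l1Weight (α : ℝ) (t : ℕ → ℝ) (m j : ℕ) : ℝ :=
  (kernelPrim α (t m) (t j) - kernelPrim α (t m) (t (j - 1))) / (t j - t (j - 1))

/-- The L1 operator without the factor `1 / Γ(1 - α)`. -/
noncomputable def l1Sum (α : ℝ) (t V : ℕ → ℝ) (m : ℕ) : ℝ :=
  ∑ j ∈ Finset.Ioc 0 m, (V j - V (j - 1)) * l1Weight α t m j

lemma deltaL1_eq {α : ℝ} (hα : α < 1) (t V : ℕ → ℝ) (m : ℕ) :
    deltaL1 α t V m = 1 / Real.Gamma (1 - α) * l1Sum α t V m := by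
  unfold deltaL1 l1Sum l1Weight
  congr 1
  refine Finset.sum_congr rfl fun j _ => ?_
  rw [integral_kernel hα]
  ring

lemma l1Weight_ge {α : ℝ} {t : ℕ → ℝ} {m j : ℕ} (hα0 : 0 < α) (hα1 : α < 1) (h0 : t 0 = 0)
    (ht : StrictMonoOn t (Iic m)) (hj : 1 ≤ j) (hjm : j ≤ m) :
    t m ^ (-α) ≤ l1Weight α t m j := by
  have h1 : t (j - 1) < t j := ht (mem_Iic.2 (by omega)) (mem_Iic.2 hjm) (by omega)
  have h2 : t j ≤ t m := ht.monotoneOn (mem_Iic.2 hjm) (mem_Iic.2 le_rfl) hjm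
  have h3 : 0 ≤ t (j - 1) := by
    rw [← h0]; exact ht.monotoneOn (mem_Iic.2 (by omega)) (mem_Iic.2 (by omega)) (by omega)
  have h4 := kernel_mul_le_kernelPrim hα0 hα1 h1 h2
  rw [l1Weight, le_div_iff₀ (sub_pos.2 h1)]
  refine le_trans (mul_le_mul_of_nonneg_right ?_ (sub_pos.2 h1).le) h4
  exact Real.rpow_le_rpow_of_nonpos (by linarith) (by linarith) (by linarith)

lemma l1Weight_le_succ {α : ℝ} {t : ℕ → ℝ} {m j : ℕ} (hα0 : 0 < α) (hα1 : α < 1)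
    (ht : StrictMonoOn t (Iic m)) (hj : 1 ≤ j) (hjm : j + 1 ≤ m) :
    l1Weight α t m j ≤ l1Weight α t m (j + 1) := by
  have h1 : t (j - 1) < t j := ht (mem_Iic.2 (by omega)) (mem_Iic.2 (by omega)) (by omega)
  have h2 : t j < t (j + 1) := ht (mem_Iic.2 (by omega)) (mem_Iic.2 hjm) (by omega)
  have h3 : t (j + 1) ≤ t m := ht.monotoneOn (mem_Iic.2 hjm) (mem_Iic.2 le_rfl) hjm
  calc l1Weight α t m j ≤ (t m - t j) ^ (-α) := by
        rw [l1Weight, div_le_iff₀ (sub_pos.2 h1)]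
        exact kernelPrim_le_kernel_mul hα0 hα1 h1 (by linarith)
    _ ≤ l1Weight α t m (j + 1) := by
        rw [l1Weight, le_div_iff₀ (by simpa using h2)]
        exact kernel_mul_le_kernelPrim hα0 hα1 h2 h3

/-- Abel summation for increasing weights and nonpositive earlier values. -/
lemma mul_le_sum_sub_mul {w V : ℕ → ℝ} (hV0 : V 0 = 0) (n : ℕ)
    (hw : ∀ j, 1 ≤ j → j + 1 ≤ n → w j ≤ w (j + 1)) (hV : ∀ j < n, V j ≤ 0) :
    w n * V n ≤ ∑ j ∈ Finset.Ioc 0 n, (V j - V (j - 1)) * w j := by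
  induction n with
  | zero => simp [hV0]
  | succ n ih =>
    have h := ih (fun j hj hjn => hw j hj (by omega)) (fun j hj => hV j (by omega))
    rw [Finset.sum_Ioc_succ_top (Nat.zero_le n), Nat.add_sub_cancel]
    rcases Nat.eq_zero_or_pos n with rfl | hn
    · simp [hV0, mul_comm]
    · have h1 := hw n hn le_rfl
      have h2 := hV n (by omega)
      nlinarith

lemma l1Sum_sub (α : ℝ) (t V W : ℕ → ℝ) (m : ℕ) :
    l1Sum α t (fun j => V j - W j) m = l1Sum α t V m - l1Sum α t W m := by
  simp only [l1Sum, ← Finset.sum_sub_distrib]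
  exact Finset.sum_congr rfl fun j _ => by ring

lemma l1Sum_add (α : ℝ) (t V W : ℕ → ℝ) (m : ℕ) :
    l1Sum α t (fun j => V j + W j) m = l1Sum α t V m + l1Sum α t W m := by
  simp only [l1Sum, ← Finset.sum_add_distrib]
  exact Finset.sum_congr rfl fun j _ => by ring

lemma l1Sum_const_mul (α c : ℝ) (t V : ℕ → ℝ) (m : ℕ) :
    l1Sum α t (fun j => c * V j) m = c * l1Sum α t V m := by
  simp only [l1Sum, Finset.mul_sum]
  exact Finset.sum_congr rfl fun j _ => by ring

lemma l1Sum_sum (α : ℝ) (t : ℕ → ℝ) (s : Finset ℕ) (w : ℕ → ℝ) (b : ℕ → ℕ → ℝ) (m : ℕ) :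
    l1Sum α t (fun j => ∑ k ∈ s, w k * b k j) m = ∑ k ∈ s, w k * l1Sum α t (b k) m := by
  simp only [l1Sum, Finset.mul_sum]
  rw [Finset.sum_comm]
  refine Finset.sum_congr rfl fun j _ => ?_
  rw [← Finset.sum_sub_distrib, Finset.sum_mul]
  exact Finset.sum_congr rfl fun k _ => by ring

/-- Discrete comparison principle for the L1 operator. -/
lemma le_of_l1Sum_le {α : ℝ} {t V B : ℕ → ℝ} {M : ℕ} (hα0 : 0 < α) (hα1 : α < 1) (h0 : t 0 = 0)
    (ht : StrictMonoOn t (Iic M)) (hV0 : V 0 = B 0)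
    (h : ∀ m, 1 ≤ m → m ≤ M → l1Sum α t V m ≤ l1Sum α t B m) :
    ∀ m, m ≤ M → V m ≤ B m := by
  intro m
  induction m using Nat.strong_induction_on with
  | _ m ih =>
    intro hm
    rcases Nat.eq_zero_or_pos m with rfl | hm0
    · exact hV0.le
    have htm : StrictMonoOn t (Iic m) := ht.mono (Iic_subset_Iic.2 hm)
    have h1 := mul_le_sum_sub_mul (w := l1Weight α t m) (V := fun j => V j - B j)
      (by simp [hV0]) m (fun j hj hjm => l1Weight_le_succ hα0 hα1 htm hj hjm)
      (fun j hj => sub_nonpos.2 (ih j hj (by omega)))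
    have h2 := l1Sum_sub α t V B m
    have h3 := h m hm0 hm
    have h4 : 0 < t m := by
      rw [← h0]; exact ht (mem_Iic.2 (by omega)) (mem_Iic.2 hm) hm0
    have h5 := l1Weight_ge hα0 hα1 h0 htm hm0 le_rfl
    have h6 : 0 < l1Weight α t m m := lt_of_lt_of_le (by positivity) h5
    unfold l1Sum at h2 h3
    have h7 : l1Weight α t m m * (V m - B m) ≤ 0 := by linarith
    by_contra hlt
    have := mul_pos h6 (sub_pos.2 (not_le.1 hlt))
    linarith

lemma sum_Ioc_sub (g : ℕ → ℝ) {k m : ℕ} (hkm : k ≤ m) :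
    ∑ j ∈ Finset.Ioc k m, (g j - g (j - 1)) = g m - g k := by
  induction m, hkm using Nat.le_induction with
  | base => simp
  | succ n hn ih => rw [Finset.sum_Ioc_succ_top hn, ih, Nat.add_sub_cancel]; ring

lemma mul_le_sum_Ioc_of_monotone {α : ℝ} {t b : ℕ → ℝ} {k m : ℕ} (hα0 : 0 < α) (hα1 : α < 1)
    (h0 : t 0 = 0) (ht : StrictMonoOn t (Iic m)) (hkm : k ≤ m) (hb0 : b 0 = 0)
    (hb : ∀ j, 1 ≤ j → j ≤ k → b (j - 1) ≤ b j) :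
    b k * t m ^ (-α) ≤ ∑ j ∈ Finset.Ioc 0 k, (b j - b (j - 1)) * l1Weight α t m j := by
  have h1 : b k * t m ^ (-α) = ∑ j ∈ Finset.Ioc 0 k, (b j - b (j - 1)) * t m ^ (-α) := by
    rw [← Finset.sum_mul, sum_Ioc_sub b (Nat.zero_le k), hb0, sub_zero]
  rw [h1]
  refine Finset.sum_le_sum fun j hj => ?_
  rw [Finset.mem_Ioc] at hj
  exact mul_le_mul_of_nonneg_left (l1Weight_ge hα0 hα1 h0 ht hj.1 (by omega))
    (sub_nonneg.2 (hb j hj.1 hj.2))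

/-- The constant in the lower bound for the L1 operator applied to a truncated power. -/
noncomputable def truncConst (α ρ C₀ : ℝ) : ℝ :=
  16 * ρ ^ (α - 3) * C₀ ^ (2 - α) / (1 - α) + 8 * ρ ^ (α - 3) * C₀ ^ 2 / (α * (α / (2 - α)))

lemma sum_truncation_le {α τ ρ C₀ : ℝ} {t : ℕ → ℝ} {k m : ℕ} (hα0 : 0 < α) (hα1 : α < 1)
    (h0 : t 0 = 0) (ht : StrictMonoOn t (Iic m)) (hk : 1 ≤ k) (hkm : k ≤ m)
    (hτ : 0 < τ) (hτk : τ ≤ t k) (hρ : 0 < ρ) (hC₀ : 0 < C₀)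
    (hratio : ∀ j, 2 ≤ j → j ≤ m → ρ * t j ≤ t (j - 1))
    (hstep : ∀ j, 1 ≤ j → j ≤ m →
      t j - t (j - 1) ≤ C₀ * (τ ^ (α / (2 - α)) * t j ^ (1 - α / (2 - α)))) :
    ∑ j ∈ Finset.Ioc k m, (1 - α) * (t (j - 1) ^ (α - 2) - t j ^ (α - 2)) *
        (kernelPrim α (t m) (t j) - kernelPrim α (t m) (t (j - 1)) -
          (t m - t (j - 1)) ^ (-α) * (t j - t (j - 1))) ≤
      truncConst α ρ C₀ * τ ^ α * t m ^ (-α - 1) := by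
  have hpos : ∀ j, 1 ≤ j → j ≤ m → 0 < t j := fun j hj hjm => by
    rw [← h0]; exact ht (mem_Iic.2 (by omega)) (mem_Iic.2 hjm) hj
  have hx : 0 < t m := hpos m (hk.trans hkm) le_rfl
  have htk : 0 < t k := hpos k hk hkm
  set x := t m with hxdef
  set L := C₀ * (τ ^ (α / (2 - α)) * x ^ (1 - α / (2 - α))) with hL
  have hL0 : 0 < L := by positivity
  set μ := α / (2 - α) with hμ
  have h2α : 0 < 2 - α := by linarith
  have hμ0 : 0 < μ := by positivity
  have hμα : μ * (2 - α) = α := by rw [hμ]; field_simp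
  have hqpos : 0 < α * μ := by positivity
  refine (Finset.sum_le_sum fun j hj => ?_).trans (b := ∑ j ∈ Finset.Ioc k m,
    (16 * ρ ^ (α - 3) * L * x ^ (α - 3) *
        ((kernelPrim α x (t j) - kernelPrim α x (t j - L)) -
          (kernelPrim α x (t (j - 1)) - kernelPrim α x (t (j - 1) - L))) +
      8 * ρ ^ (α - 3) * C₀ ^ 2 * (τ ^ μ) ^ 2 * x ^ (-α - 1) *
        ((t (j - 1) ^ (-(α * μ)) - t j ^ (-(α * μ))) / (α * μ)))) ?_
  · rw [Finset.mem_Ioc] at hj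
    exact truncation_le hα0 hα1 (hpos _ (by omega) (by omega))
      (ht (mem_Iic.2 (by omega)) (mem_Iic.2 hj.2) (by omega))
      (ht.monotoneOn (mem_Iic.2 hj.2) (mem_Iic.2 le_rfl) hj.2) hτ hρ
      (hratio j (by omega) hj.2) hC₀ (hstep j (by omega) hj.2) hL
  rw [Finset.sum_add_distrib, ← Finset.mul_sum, ← Finset.mul_sum,
    sum_Ioc_sub (fun j => kernelPrim α x (t j) - kernelPrim α x (t j - L)) hkm]
  have hS : ∑ j ∈ Finset.Ioc k m, (t (j - 1) ^ (-(α * μ)) - t j ^ (-(α * μ))) / (α * μ) =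
      (t k ^ (-(α * μ)) - x ^ (-(α * μ))) / (α * μ) := by
    rw [← Finset.sum_div]
    congr 1
    have := sum_Ioc_sub (fun j => -(t j ^ (-(α * μ)))) hkm
    rw [hxdef]
    calc _ = ∑ j ∈ Finset.Ioc k m, (-(t j ^ (-(α * μ))) - -(t (j - 1) ^ (-(α * μ)))) :=
          Finset.sum_congr rfl fun j _ => by ring
      _ = _ := by rw [this]; ring
  rw [hS]
  have hnear : kernelPrim α x (t m) - kernelPrim α x (t m - L) -
      (kernelPrim α x (t k) - kernelPrim α x (t k - L)) ≤ L ^ (1 - α) / (1 - α) := by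
    have h1 : kernelPrim α x (t m) = 0 := by
      rw [← hxdef, kernelPrim, sub_self, Real.zero_rpow (by linarith)]; simp
    have h2 : kernelPrim α x (t m - L) = -(L ^ (1 - α) / (1 - α)) := by
      rw [← hxdef, kernelPrim, sub_sub_cancel]
    have h3 : 0 ≤ kernelPrim α x (t k) - kernelPrim α x (t k - L) := by
      have htkx : t k ≤ x := ht.monotoneOn (mem_Iic.2 hkm) (mem_Iic.2 le_rfl) hkm
      obtain ⟨c, hc, h⟩ := kernelPrim_slope (x := x) hα1 (sub_lt_self (t k) hL0) htkx
      rw [h]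
      have : 0 ≤ x - c := by linarith [hc.2]
      exact mul_nonneg (Real.rpow_nonneg this _) (by linarith)
    rw [h1, h2]
    linarith
  have hLpow : L * x ^ (α - 3) * L ^ (1 - α) = C₀ ^ (2 - α) * τ ^ α * x ^ (-α - 1) := by
    have e1 : L * L ^ (1 - α) = L ^ (2 - α) := by
      rw [show 2 - α = 1 - α + 1 by ring, Real.rpow_add_one hL0.ne']; ring
    have e2 : L ^ (2 - α) = C₀ ^ (2 - α) * (τ ^ α * x ^ (2 - α - α)) := by
      rw [hL, Real.mul_rpow hC₀.le (by positivity), Real.mul_rpow (by positivity) (by positivity),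
        ← Real.rpow_mul hτ.le, ← Real.rpow_mul hx.le, hμα,
        show (1 - μ) * (2 - α) = 2 - α - α by linarith]
    have e3 : x ^ (2 - α - α) * x ^ (α - 3) = x ^ (-α - 1) := by
      rw [← Real.rpow_add hx]; congr 1; ring
    calc _ = L * L ^ (1 - α) * x ^ (α - 3) := by ring
      _ = C₀ ^ (2 - α) * τ ^ α * (x ^ (2 - α - α) * x ^ (α - 3)) := by rw [e1, e2]; ring
      _ = _ := by rw [e3]
  have hfar : (τ ^ μ) ^ 2 * (t k ^ (-(α * μ)) - x ^ (-(α * μ))) ≤ τ ^ α := by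
    have e1 : t k ^ (-(α * μ)) ≤ τ ^ (-(α * μ)) :=
      Real.rpow_le_rpow_of_nonpos hτ hτk (by linarith)
    have e2 : 0 ≤ x ^ (-(α * μ)) := by positivity
    have e3 : (τ ^ μ) ^ 2 * τ ^ (-(α * μ)) = τ ^ α := by
      rw [← Real.rpow_natCast, ← Real.rpow_mul hτ.le, ← Real.rpow_add hτ]
      congr 1
      push_cast
      linarith
    rw [← e3]
    gcongr
    linarith
  have hB1 : 16 * ρ ^ (α - 3) * L * x ^ (α - 3) *
      (kernelPrim α x (t m) - kernelPrim α x (t m - L) -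
        (kernelPrim α x (t k) - kernelPrim α x (t k - L))) ≤
      16 * ρ ^ (α - 3) * C₀ ^ (2 - α) / (1 - α) * τ ^ α * x ^ (-α - 1) := by
    calc _ ≤ 16 * ρ ^ (α - 3) * L * x ^ (α - 3) * (L ^ (1 - α) / (1 - α)) := by gcongr
      _ = 16 * ρ ^ (α - 3) * (L * x ^ (α - 3) * L ^ (1 - α)) / (1 - α) := by ring
      _ = _ := by rw [hLpow]; ring
  have hB2 : 8 * ρ ^ (α - 3) * C₀ ^ 2 * (τ ^ μ) ^ 2 * x ^ (-α - 1) *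
      ((t k ^ (-(α * μ)) - x ^ (-(α * μ))) / (α * μ)) ≤
      8 * ρ ^ (α - 3) * C₀ ^ 2 / (α * μ) * τ ^ α * x ^ (-α - 1) := by
    calc _ = 8 * ρ ^ (α - 3) * C₀ ^ 2 / (α * μ) * x ^ (-α - 1) *
          ((τ ^ μ) ^ 2 * (t k ^ (-(α * μ)) - x ^ (-(α * μ)))) := by ring
      _ ≤ 8 * ρ ^ (α - 3) * C₀ ^ 2 / (α * μ) * x ^ (-α - 1) * τ ^ α := by gcongr
      _ = _ := by ring
  calc _ ≤ _ := add_le_add hB1 hB2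
    _ = truncConst α ρ C₀ * τ ^ α * x ^ (-α - 1) := by rw [truncConst, ← hμ]; ring

/-- Lower bound for the L1 operator applied to `t j ^ (α - 1)` truncated at index `k`. -/
lemma le_l1Sum_truncPow {α τ ρ C₀ : ℝ} {t b : ℕ → ℝ} {k m : ℕ} (hα0 : 0 < α) (hα1 : α < 1)
    (h0 : t 0 = 0) (ht : StrictMonoOn t (Iic m)) (hk : 1 ≤ k) (hkm : k ≤ m)
    (hτ : 0 < τ) (hτk : τ ≤ t k) (hρ : 0 < ρ) (hC₀ : 0 < C₀)
    (hratio : ∀ j, 2 ≤ j → j ≤ m → ρ * t j ≤ t (j - 1))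
    (hstep : ∀ j, 1 ≤ j → j ≤ m →
      t j - t (j - 1) ≤ C₀ * (τ ^ (α / (2 - α)) * t j ^ (1 - α / (2 - α))))
    (hb0 : b 0 = 0) (hb : ∀ j, 1 ≤ j → j ≤ k → b (j - 1) ≤ b j)
    (hbk : ∀ j, k ≤ j → j ≤ m → b j = t j ^ (α - 1)) :
    ((1 - α) * t k ^ α - truncConst α ρ C₀ * τ ^ α) * t m ^ (-α - 1) ≤ l1Sum α t b m := by
  have hpos : ∀ j, 1 ≤ j → j ≤ m → 0 < t j := fun j hj hjm => by
    rw [← h0]; exact ht (mem_Iic.2 (by omega)) (mem_Iic.2 hjm) hj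
  have h1 := mul_le_sum_Ioc_of_monotone hα0 hα1 h0 ht hkm hb0 hb
  rw [hbk k le_rfl hkm] at h1
  have h2 := margin_le hα0 hα1 (hpos k hk hkm)
    (ht.monotoneOn (mem_Iic.2 hkm) (mem_Iic.2 le_rfl) hkm)
  have h3 := sum_truncation_le hα0 hα1 h0 ht hk hkm hτ hτk hρ hC₀ hratio hstep
  have h4 : ∑ j ∈ Finset.Ioc k m,
      (powKernelPrim α (t m) (t j) - powKernelPrim α (t m) (t (j - 1)) -
        (1 - α) * (t (j - 1) ^ (α - 2) - t j ^ (α - 2)) *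
        (kernelPrim α (t m) (t j) - kernelPrim α (t m) (t (j - 1)) -
          (t m - t (j - 1)) ^ (-α) * (t j - t (j - 1)))) ≤
      ∑ j ∈ Finset.Ioc k m, (b j - b (j - 1)) * l1Weight α t m j := by
    refine Finset.sum_le_sum fun j hj => ?_
    rw [Finset.mem_Ioc] at hj
    refine (powKernelPrim_sub_le hα0 hα1 (hpos _ (by omega) (by omega))
      (ht (mem_Iic.2 (by omega)) (mem_Iic.2 hj.2) (by omega))
      (ht.monotoneOn (mem_Iic.2 hj.2) (mem_Iic.2 le_rfl) hj.2)).trans_eq ?_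
    rw [hbk j (by omega) hj.2, hbk (j - 1) (by omega) (by omega), l1Weight]
    ring
  rw [Finset.sum_sub_distrib,
    sum_Ioc_sub (fun j => powKernelPrim α (t m) (t j)) hkm] at h4
  have h5 : powKernelPrim α (t m) (t m) = 0 := by
    rw [powKernelPrim, sub_self, Real.zero_rpow (by linarith)]; simp
  rw [h5] at h4
  have h6 : l1Sum α t b m = ∑ j ∈ Finset.Ioc 0 k, (b j - b (j - 1)) * l1Weight α t m j +
      ∑ j ∈ Finset.Ioc k m, (b j - b (j - 1)) * l1Weight α t m j :=
    (Finset.sum_Ioc_consecutive _ (Nat.zero_le k) hkm).symm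
  rw [h6]
  linarith

/-- The power `t j ^ (α - 1)`, set to zero below index `k`. -/
noncomputable def truncPow (α : ℝ) (t : ℕ → ℝ) (k j : ℕ) : ℝ :=
  if j < k then 0 else t j ^ (α - 1)

/-- The power `t j ^ (α - 1)`, frozen on `0 < j < k` and vanishing at `j = 0`. -/
noncomputable def plateauPow (α : ℝ) (t : ℕ → ℝ) (k j : ℕ) : ℝ :=
  if j = 0 then 0 else if j < k then t k ^ (α - 1) else t j ^ (α - 1)

/-- Weights making the lower bounds for the truncated powers telescope. -/
noncomputable def barrierWeight (α γ : ℝ) (t : ℕ → ℝ) (k : ℕ) : ℝ :=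
  t 1 ^ (γ + 1) * (t k ^ (-α) * (t k ^ (α - γ) - t (k - 1) ^ (α - γ)))

/-- The barrier, a superposition of truncated powers. -/
noncomputable def barrier (α γ : ℝ) (t : ℕ → ℝ) (K M j : ℕ) : ℝ :=
  t 1 ^ (γ + 1) * t K ^ (-γ) * plateauPow α t K j +
    ∑ k ∈ Finset.Ioc K M, barrierWeight α γ t k * truncPow α t k j

lemma barrier_zero (α γ : ℝ) (t : ℕ → ℝ) (K M : ℕ) : barrier α γ t K M 0 = 0 := by
  unfold barrier
  rw [plateauPow, if_pos rfl, mul_zero, zero_add]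
  refine Finset.sum_eq_zero fun k hk => ?_
  rw [Finset.mem_Ioc] at hk
  rw [truncPow, if_pos (by omega), mul_zero]

lemma l1Sum_barrier (α γ : ℝ) (t : ℕ → ℝ) (K M m : ℕ) :
    l1Sum α t (barrier α γ t K M) m =
      t 1 ^ (γ + 1) * t K ^ (-γ) * l1Sum α t (plateauPow α t K) m +
        ∑ k ∈ Finset.Ioc K M, barrierWeight α γ t k * l1Sum α t (truncPow α t k) m := by
  rw [← l1Sum_sum, ← l1Sum_const_mul, ← l1Sum_add]
  rfl

lemma l1Sum_truncPow_of_lt (α : ℝ) (t : ℕ → ℝ) {k m : ℕ} (h : m < k) :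
    l1Sum α t (truncPow α t k) m = 0 := by
  refine Finset.sum_eq_zero fun j hj => ?_
  rw [Finset.mem_Ioc] at hj
  rw [truncPow, truncPow, if_pos (by omega), if_pos (by omega)]
  ring

lemma barrierWeight_nonneg {α γ : ℝ} {t : ℕ → ℝ} {k : ℕ} (hγ : γ < α) (h1 : 0 < t 1)
    (hk : 0 < t (k - 1)) (hkk : t (k - 1) ≤ t k) : 0 ≤ barrierWeight α γ t k := by
  have : t (k - 1) ^ (α - γ) ≤ t k ^ (α - γ) := Real.rpow_le_rpow hk.le hkk (by linarith)
  have hk' : 0 < t k := hk.trans_le hkk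
  exact mul_nonneg (by positivity) (mul_nonneg (by positivity) (by linarith))

lemma plateauPow_step {α : ℝ} {t : ℕ → ℝ} {K j : ℕ} (hK : 0 < t K) (hj : 1 ≤ j) (hjK : j ≤ K) :
    plateauPow α t K j = t K ^ (α - 1) ∧ plateauPow α t K (j - 1) ≤ plateauPow α t K j := by
  have h1 : ∀ i, 1 ≤ i → i ≤ K → plateauPow α t K i = t K ^ (α - 1) := fun i hi hiK => by
    rcases hiK.lt_or_eq with h | rfl
    · rw [plateauPow, if_neg (by omega), if_pos h]
    · rw [plateauPow, if_neg (by omega), if_neg (by omega)]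
  refine ⟨h1 j hj hjK, ?_⟩
  rw [h1 j hj hjK]
  rcases Nat.eq_zero_or_pos (j - 1) with h | h
  · rw [h, plateauPow, if_pos rfl]; positivity
  · exact (h1 (j - 1) h (by omega)).le

/-- The barrier dominates the prescribed right-hand side. -/
lemma le_l1Sum_barrier {α γ ρ C₀ Q : ℝ} {t : ℕ → ℝ} {K M : ℕ} (hα0 : 0 < α) (hα1 : α < 1)
    (hγ : γ < α) (h0 : t 0 = 0) (ht : StrictMonoOn t (Iic M)) (hK : 1 ≤ K) (hKM : K ≤ M)
    (hρ : 0 < ρ) (hC₀ : 0 < C₀) (hratio : ∀ j, 2 ≤ j → j ≤ M → ρ * t j ≤ t (j - 1))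
    (hstep : ∀ j, 1 ≤ j → j ≤ M →
      t j - t (j - 1) ≤ C₀ * (t 1 ^ (α / (2 - α)) * t j ^ (1 - α / (2 - α))))
    (hQ : t K ≤ Q * t 1)
    (hbig : K < M → truncConst α ρ C₀ * t 1 ^ α ≤ (1 - α) / 2 * t K ^ α)
    {m : ℕ} (hm : 1 ≤ m) (hmM : m ≤ M) :
    min (Q ^ (-|γ + 1 - α|)) ((1 - α) / 2) * (t 1 / t m) ^ (γ + 1) ≤
      l1Sum α t (barrier α γ t K M) m := by
  have hpos : ∀ j, 1 ≤ j → j ≤ M → 0 < t j := fun j hj hjm => by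
    rw [← h0]; exact ht (mem_Iic.2 (by omega)) (mem_Iic.2 hjm) hj
  have hle : ∀ i j, i ≤ j → j ≤ M → t i ≤ t j := fun i j hij hj =>
    ht.monotoneOn (mem_Iic.2 (by omega)) (mem_Iic.2 hj) hij
  have hτ : 0 < t 1 := hpos 1 le_rfl (by omega)
  have hx : 0 < t m := hpos m hm hmM
  have htK : 0 < t K := hpos K hK hKM
  have htm : StrictMonoOn t (Iic m) := ht.mono (Iic_subset_Iic.2 hmM)
  rw [l1Sum_barrier]
  have hdiv : (t 1 / t m) ^ (γ + 1) = t 1 ^ (γ + 1) * t m ^ (-(γ + 1)) := by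
    rw [Real.div_rpow hτ.le hx.le, Real.rpow_neg hx.le, div_eq_mul_inv]
  rw [hdiv]
  rcases le_or_gt m K with hmK | hmK
  · have hS : ∑ k ∈ Finset.Ioc K M, barrierWeight α γ t k * l1Sum α t (truncPow α t k) m = 0 :=
      Finset.sum_eq_zero fun k hk => by
        rw [Finset.mem_Ioc] at hk
        rw [l1Sum_truncPow_of_lt α t (by omega), mul_zero]
    rw [hS, add_zero]
    have h1 : plateauPow α t K m * t m ^ (-α) ≤ l1Sum α t (plateauPow α t K) m :=
      mul_le_sum_Ioc_of_monotone hα0 hα1 h0 htm le_rfl (by rw [plateauPow, if_pos rfl])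
        (fun j hj hjm => (plateauPow_step htK hj (by omega)).2)
    rw [(plateauPow_step htK hm hmK).1] at h1
    have hQ1 : 0 < Q := pos_of_mul_pos_left (htK.trans_le hQ) hτ.le
    have hz1 : t m / t K ≤ 1 := (div_le_one htK).2 (hle m K hmK hKM)
    have hz2 : Q⁻¹ ≤ t m / t K := by
      rw [inv_eq_one_div, div_le_div_iff₀ hQ1 htK]
      have := hle 1 m hm hmM
      nlinarith
    have hz0 : 0 < t m / t K := by positivity
    have h2 : Q ^ (-|γ + 1 - α|) ≤ (t m / t K) ^ (γ + 1 - α) := by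
      calc Q ^ (-|γ + 1 - α|) = (Q⁻¹) ^ |γ + 1 - α| := by
            rw [Real.inv_rpow hQ1.le, Real.rpow_neg hQ1.le]
        _ ≤ (t m / t K) ^ |γ + 1 - α| :=
            Real.rpow_le_rpow (by positivity) hz2 (abs_nonneg _)
        _ ≤ (t m / t K) ^ (γ + 1 - α) :=
            Real.rpow_le_rpow_of_exponent_ge hz0 hz1 (le_abs_self _)
    have h3 : (t m / t K) ^ (γ + 1 - α) * t m ^ (-(γ + 1)) =
        t K ^ (-γ) * (t K ^ (α - 1) * t m ^ (-α)) := by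
      rw [Real.div_rpow hx.le htK.le, div_eq_mul_inv, ← Real.rpow_neg htK.le,
        mul_right_comm, ← Real.rpow_add hx, ← mul_assoc, ← Real.rpow_add htK, mul_comm]
      congr 2 <;> ring
    calc _ ≤ (t m / t K) ^ (γ + 1 - α) * (t 1 ^ (γ + 1) * t m ^ (-(γ + 1))) := by
          gcongr
          exact (min_le_left _ _).trans h2
      _ = t 1 ^ (γ + 1) * t K ^ (-γ) * (t K ^ (α - 1) * t m ^ (-α)) := by
          rw [mul_left_comm, h3]; ring
      _ ≤ _ := by gcongr
  · have hbig' := hbig (by omega)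
    have hlow : ∀ k, K ≤ k → k ≤ m → ∀ b : ℕ → ℝ, b 0 = 0 →
        (∀ j, 1 ≤ j → j ≤ k → b (j - 1) ≤ b j) →
        (∀ j, k ≤ j → j ≤ m → b j = t j ^ (α - 1)) →
        (1 - α) / 2 * t k ^ α * t m ^ (-α - 1) ≤ l1Sum α t b m := by
      intro k hKk hkm b hb0 hb hbk
      refine le_trans ?_ (le_l1Sum_truncPow hα0 hα1 h0 htm (by omega) hkm hτ
        (hle 1 k (by omega) (by omega)) hρ hC₀ (fun j hj hjm => hratio j hj (by omega))
        (fun j hj hjm => hstep j hj (by omega)) hb0 hb hbk)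
      have : t K ^ α ≤ t k ^ α := Real.rpow_le_rpow htK.le (hle K k hKk (by omega)) hα0.le
      gcongr
      nlinarith
    have hplateau := hlow K le_rfl hmK.le (plateauPow α t K) (by rw [plateauPow, if_pos rfl])
      (fun j hj hjK => (plateauPow_step htK hj hjK).2)
      (fun j hj hjm => by rw [plateauPow, if_neg (by omega), if_neg (by omega)])
    have hsum : (1 - α) / 2 * t m ^ (-α - 1) * t 1 ^ (γ + 1) * (t m ^ (α - γ) - t K ^ (α - γ)) ≤
        ∑ k ∈ Finset.Ioc K M, barrierWeight α γ t k * l1Sum α t (truncPow α t k) m := by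
      have hzero : ∑ k ∈ Finset.Ioc m M,
          barrierWeight α γ t k * l1Sum α t (truncPow α t k) m = 0 :=
        Finset.sum_eq_zero fun k hk => by
          rw [Finset.mem_Ioc] at hk
          rw [l1Sum_truncPow_of_lt α t (by omega), mul_zero]
      rw [← Finset.sum_Ioc_consecutive _ hmK.le hmM, hzero, add_zero,
        ← sum_Ioc_sub (fun k => t k ^ (α - γ)) hmK.le, Finset.mul_sum]
      refine Finset.sum_le_sum fun k hk => ?_
      rw [Finset.mem_Ioc] at hk
      have hk0 : 0 < t k := hpos k (by omega) (by omega)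
      have h1 := hlow k (by omega) hk.2 (truncPow α t k) (by rw [truncPow, if_pos (by omega)])
        (fun j hj hjk => by
          rw [truncPow, if_pos (by omega), truncPow]
          split_ifs
          · exact le_rfl
          · exact Real.rpow_nonneg (hpos j hj (by omega)).le _)
        (fun j hj hjm => by rw [truncPow, if_neg (by omega)])
      have hw := barrierWeight_nonneg (k := k) hγ hτ (hpos _ (by omega) (by omega))
        (hle (k - 1) k (by omega) (by omega))
      refine le_trans (le_of_eq ?_) (mul_le_mul_of_nonneg_left h1 hw)
      have e : t k ^ (-α) * t k ^ α = 1 := by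
        rw [← Real.rpow_add hk0, neg_add_cancel, Real.rpow_zero]
      unfold barrierWeight
      linear_combination -(t 1 ^ (γ + 1) * (t k ^ (α - γ) - t (k - 1) ^ (α - γ)) *
        ((1 - α) / 2 * t m ^ (-α - 1))) * e
    have e1 : t K ^ (-γ) * t K ^ α = t K ^ (α - γ) := by
      rw [← Real.rpow_add htK]; congr 1; ring
    have e2 : t m ^ (-α - 1) * t m ^ (α - γ) = t m ^ (-(γ + 1)) := by
      rw [← Real.rpow_add hx]; congr 1; ring
    have h1 := mul_le_mul_of_nonneg_left hplateau
      (show 0 ≤ t 1 ^ (γ + 1) * t K ^ (-γ) by positivity)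
    calc _ ≤ (1 - α) / 2 * (t 1 ^ (γ + 1) * t m ^ (-(γ + 1))) := by
          gcongr
          exact min_le_right _ _
      _ = t 1 ^ (γ + 1) * t K ^ (-γ) * ((1 - α) / 2 * t K ^ α * t m ^ (-α - 1)) +
          (1 - α) / 2 * t m ^ (-α - 1) * t 1 ^ (γ + 1) * (t m ^ (α - γ) - t K ^ (α - γ)) := by
          rw [← e2]
          linear_combination -((1 - α) / 2 * t 1 ^ (γ + 1) * t m ^ (-α - 1)) * e1
      _ ≤ _ := add_le_add h1 hsum

lemma rpow_sub_le_primitive {α γ x y : ℝ} {G : ℝ → ℝ} (hα0 : 0 < α) (hγ : γ < α) (hx : 0 < x)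
    (hxy : x ≤ y) (hG : ∀ s, 0 < s → HasDerivAt G ((α - γ) * s ^ (-γ - 1)) s) :
    y ^ (-α) * (y ^ (α - γ) - x ^ (α - γ)) ≤ G y - G x := by
  have hder : ∀ s, 0 < s → HasDerivAt (fun s => G s - y ^ (-α) * s ^ (α - γ))
      ((α - γ) * s ^ (-γ - 1) - y ^ (-α) * ((α - γ) * s ^ (α - γ - 1))) s := fun s hs =>
    (hG s hs).sub ((Real.hasDerivAt_rpow_const (Or.inl hs.ne')).const_mul _)
  have key : MonotoneOn (fun s => G s - y ^ (-α) * s ^ (α - γ)) (Icc x y) := by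
    refine monotoneOn_of_deriv_nonneg (convex_Icc x y)
      (fun s hs => (hder s (hx.trans_le hs.1)).continuousAt.continuousWithinAt)
      (fun s hs => ?_) (fun s hs => ?_)
    · rw [interior_Icc] at hs
      exact (hder s (hx.trans hs.1)).differentiableAt.differentiableWithinAt
    · rw [interior_Icc] at hs
      have hs0 : 0 < s := hx.trans hs.1
      rw [(hder s hs0).deriv]
      have h1 : y ^ (-α) ≤ s ^ (-α) := Real.rpow_le_rpow_of_nonpos hs0 hs.2.le (by linarith)
      have h2 : s ^ (-γ - 1) = s ^ (-α) * s ^ (α - γ - 1) := by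
        rw [← Real.rpow_add hs0]; congr 1; ring
      rw [h2, show (α - γ) * (s ^ (-α) * s ^ (α - γ - 1)) -
        y ^ (-α) * ((α - γ) * s ^ (α - γ - 1)) =
        (s ^ (-α) - y ^ (-α)) * ((α - γ) * s ^ (α - γ - 1)) by ring]
      exact mul_nonneg (by linarith) (mul_nonneg (by linarith) (by positivity))
  have h := key (left_mem_Icc.2 hxy) (right_mem_Icc.2 hxy) hxy
  simp only at h
  linarith

lemma barrier_le_primitive {α γ : ℝ} {t : ℕ → ℝ} {K M : ℕ} {G : ℝ → ℝ} (hα0 : 0 < α)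
    (hα1 : α < 1)
    (hγ : γ < α) (h0 : t 0 = 0) (ht : StrictMonoOn t (Iic M)) (hK : 1 ≤ K) (hKM : K ≤ M)
    (hG : ∀ s, 0 < s → HasDerivAt G ((α - γ) * s ^ (-γ - 1)) s)
    {j : ℕ} (hj : 1 ≤ j) (hjM : j ≤ M) :
    barrier α γ t K M j ≤
      t 1 ^ (γ + 1) * (t K ^ (-γ) + max 0 (G (t j) - G (t K))) * t j ^ (α - 1) := by
  have hpos : ∀ j, 1 ≤ j → j ≤ M → 0 < t j := fun j hj hjm => by
    rw [← h0]; exact ht (mem_Iic.2 (by omega)) (mem_Iic.2 hjm) hj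
  have hle : ∀ i j, i ≤ j → j ≤ M → t i ≤ t j := fun i j hij hj =>
    ht.monotoneOn (mem_Iic.2 (by omega)) (mem_Iic.2 hj) hij
  have hτ : 0 < t 1 := hpos 1 le_rfl (by omega)
  have hx : 0 < t j := hpos j hj hjM
  have htK : 0 < t K := hpos K hK hKM
  have hsum0 : ∀ n, j ≤ n → ∑ k ∈ Finset.Ioc n M, barrierWeight α γ t k * truncPow α t k j = 0 :=
    fun n hn => Finset.sum_eq_zero fun k hk => by
      rw [Finset.mem_Ioc] at hk
      rw [truncPow, if_pos (by omega), mul_zero]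
  unfold barrier
  rw [mul_add, add_mul]
  refine add_le_add ?_ ?_
  · gcongr
    rcases le_or_gt j K with hjK | hjK
    · rw [(plateauPow_step htK hj hjK).1]
      exact Real.rpow_le_rpow_of_nonpos hx (hle j K hjK hKM) (by linarith)
    · rw [plateauPow, if_neg (by omega), if_neg (by omega)]
  · rcases le_or_gt j K with hjK | hjK
    · rw [hsum0 K hjK]
      exact mul_nonneg (mul_nonneg (by positivity) (le_max_left _ _)) (by positivity)
    · rw [← Finset.sum_Ioc_consecutive _ hjK.le hjM, hsum0 j le_rfl, add_zero]
      have h1 : ∑ k ∈ Finset.Ioc K j, barrierWeight α γ t k * truncPow α t k j ≤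
          ∑ k ∈ Finset.Ioc K j, t 1 ^ (γ + 1) * t j ^ (α - 1) * (G (t k) - G (t (k - 1))) := by
        refine Finset.sum_le_sum fun k hk => ?_
        rw [Finset.mem_Ioc] at hk
        rw [truncPow, if_neg (by omega), barrierWeight]
        have h2 := rpow_sub_le_primitive hα0 hγ (hpos (k - 1) (by omega) (by omega))
          (hle (k - 1) k (by omega) (by omega)) hG
        calc _ = t 1 ^ (γ + 1) * t j ^ (α - 1) *
              (t k ^ (-α) * (t k ^ (α - γ) - t (k - 1) ^ (α - γ))) := by ring
          _ ≤ _ := by gcongr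
      refine h1.trans ?_
      rw [← Finset.mul_sum, sum_Ioc_sub (fun k => G (t k)) hjK.le]
      calc _ = t 1 ^ (γ + 1) * (G (t j) - G (t K)) * t j ^ (α - 1) := by ring
        _ ≤ _ := by
          gcongr
          exact le_max_right _ _

/-- The barrier is dominated by the stability majorant. -/
lemma barrier_le_Vcal {α γ Q : ℝ} {t : ℕ → ℝ} {K M : ℕ} (hα0 : 0 < α) (hα1 : α < 1)
    (hγ : γ < α) (h0 : t 0 = 0) (ht : StrictMonoOn t (Iic M)) (hK : 1 ≤ K) (hKM : K ≤ M)
    (hQ : t K ≤ Q * t 1) {j : ℕ} (hj : 1 ≤ j) (hjM : j ≤ M) :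
    barrier α γ t K M j ≤ (1 + (α - γ) / |γ| + Q ^ (-γ)) * Vcal α γ (t 1) (t j) := by
  have hpos : ∀ j, 1 ≤ j → j ≤ M → 0 < t j := fun j hj hjm => by
    rw [← h0]; exact ht (mem_Iic.2 (by omega)) (mem_Iic.2 hjm) hj
  have hle : ∀ i j, i ≤ j → j ≤ M → t i ≤ t j := fun i j hij hj =>
    ht.monotoneOn (mem_Iic.2 (by omega)) (mem_Iic.2 hj) hij
  have hτ : 0 < t 1 := hpos 1 le_rfl (by omega)
  have hx : 0 < t j := hpos j hj hjM
  have htK : 0 < t K := hpos K hK hKM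
  have h1K : t 1 ≤ t K := hle 1 K hK hKM
  have h1j : t 1 ≤ t j := hle 1 j hj hjM
  have hQ1 : 0 < Q := pos_of_mul_pos_left (htK.trans_le hQ) hτ.le
  have hQ' : 0 ≤ Q ^ (-γ) := by positivity
  have hβ : 0 ≤ (α - γ) / |γ| := div_nonneg (by linarith) (abs_nonneg _)
  have hcancel : t 1 ^ (γ + 1) * t 1 ^ (-γ) = t 1 := by
    rw [← Real.rpow_add hτ, show γ + 1 + -γ = 1 by ring, Real.rpow_one]
  have hprim : γ ≠ 0 → ∀ s, 0 < s →
      HasDerivAt (fun s : ℝ => -((α - γ) / γ) * s ^ (-γ)) ((α - γ) * s ^ (-γ - 1)) s := by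
    intro hγ0 s hs
    refine ((Real.hasDerivAt_rpow_const (p := -γ) (Or.inl hs.ne')).const_mul _).congr_deriv ?_
    field_simp
  unfold Vcal
  rcases lt_trichotomy γ 0 with hneg | rfl | hgpos
  · rw [if_neg (by linarith), if_neg hneg.ne]
    refine (barrier_le_primitive hα0 hα1 hγ h0 ht hK hKM (hprim hneg.ne) hj hjM).trans ?_
    have h1 : t K ^ (-γ) ≤ Q ^ (-γ) * t j ^ (-γ) := by
      rw [← Real.mul_rpow hQ1.le hx.le]
      exact Real.rpow_le_rpow htK.le (hQ.trans (by gcongr)) (by linarith)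
    have h2 : max 0 (-((α - γ) / γ) * t j ^ (-γ) - -((α - γ) / γ) * t K ^ (-γ)) ≤
        (α - γ) / |γ| * t j ^ (-γ) := by
      rw [abs_of_neg hneg, ← div_neg]
      have : 0 ≤ (α - γ) / -γ := div_nonneg (by linarith) (by linarith)
      refine max_le (by positivity) ?_
      have : 0 ≤ (α - γ) / -γ * t K ^ (-γ) := by positivity
      linarith
    have h3 : t 1 * (t 1 / t j) ^ γ = t 1 ^ (γ + 1) * t j ^ (-γ) := by
      rw [Real.div_rpow hτ.le hx.le, Real.rpow_add_one hτ.ne', Real.rpow_neg hx.le]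
      ring
    calc _ ≤ t 1 ^ (γ + 1) * (Q ^ (-γ) * t j ^ (-γ) + (α - γ) / |γ| * t j ^ (-γ)) *
          t j ^ (α - 1) := by gcongr
      _ = ((α - γ) / |γ| + Q ^ (-γ)) * (t 1 ^ (γ + 1) * t j ^ (-γ) * t j ^ (α - 1)) := by ring
      _ ≤ (1 + (α - γ) / |γ| + Q ^ (-γ)) * (t 1 ^ (γ + 1) * t j ^ (-γ) * t j ^ (α - 1)) := by
          gcongr
          linarith
      _ = _ := by rw [← h3]; ring
  · rw [if_neg (lt_irrefl _), if_pos rfl]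
    refine (barrier_le_primitive (G := fun s => α * Real.log s) hα0 hα1 hγ h0 ht hK hKM
      (fun s hs => ?_) hj hjM).trans ?_
    · refine ((Real.hasDerivAt_log hs.ne').const_mul α).congr_deriv ?_
      rw [neg_zero, zero_sub, sub_zero, Real.rpow_neg_one]
    have hlog : 0 ≤ Real.log (t j / t 1) := Real.log_nonneg ((one_le_div hτ).2 h1j)
    have h2 : max 0 (α * Real.log (t j) - α * Real.log (t K)) ≤ Real.log (t j / t 1) := by
      refine max_le hlog ?_
      have h3 : Real.log (t 1) ≤ Real.log (t K) := Real.log_le_log hτ h1K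
      have h4 := Real.log_div hx.ne' hτ.ne'
      have h5 : α * (Real.log (t j) - Real.log (t 1)) ≤ Real.log (t j / t 1) := by
        rw [← h4]; nlinarith
      nlinarith
    rw [neg_zero, zero_add, Real.rpow_zero, Real.rpow_one, Real.rpow_zero]
    calc _ ≤ t 1 * (1 + Real.log (t j / t 1)) * t j ^ (α - 1) := by gcongr
      _ = 1 * (t 1 * t j ^ (α - 1) * (1 + Real.log (t j / t 1))) := by ring
      _ ≤ _ := by
        gcongr
        linarith
  · rw [if_pos hgpos]
    refine (barrier_le_primitive hα0 hα1 hγ h0 ht hK hKM (hprim hgpos.ne') hj hjM).trans ?_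
    have h1 : t K ^ (-γ) ≤ t 1 ^ (-γ) := Real.rpow_le_rpow_of_nonpos hτ h1K (by linarith)
    have h2 : max 0 (-((α - γ) / γ) * t j ^ (-γ) - -((α - γ) / γ) * t K ^ (-γ)) ≤
        (α - γ) / |γ| * t 1 ^ (-γ) := by
      refine max_le (by positivity) ?_
      rw [abs_of_pos hgpos] at hβ ⊢
      have h3 : 0 ≤ (α - γ) / γ * t j ^ (-γ) := by positivity
      have h4 := mul_le_mul_of_nonneg_left h1 hβ
      linarith
    calc _ ≤ t 1 ^ (γ + 1) * (t 1 ^ (-γ) + (α - γ) / |γ| * t 1 ^ (-γ)) * t j ^ (α - 1) := by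
          gcongr
      _ = (1 + (α - γ) / |γ|) * (t 1 ^ (γ + 1) * t 1 ^ (-γ) * t j ^ (α - 1)) := by ring
      _ ≤ _ := by
        rw [hcancel]
        exact mul_le_mul_of_nonneg_right (by linarith) (by positivity)

lemma IsMesh.strictMonoOn {T : ℝ} {M : ℕ} {t : ℕ → ℝ} (h : IsMesh T M t) :
    t 0 = 0 ∧ StrictMonoOn t (Iic M) :=
  ⟨h.2.1, strictMonoOn_Iic_of_lt_succ fun j hj => by simpa using h.2.2.1 j hj⟩

lemma QuasiGraded.ratio {r c0 C0 : ℝ} {M : ℕ} {t : ℕ → ℝ} (hr1 : 1 ≤ r) (hc0 : 0 < c0)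
    (hC0 : 0 < C0) (hτ : 0 < t 1) (h : QuasiGraded r c0 C0 M t) {j : ℕ} (hj : 2 ≤ j)
    (hjM : j ≤ M) : c0 / C0 * (1 / 2) ^ r * t j ≤ t (j - 1) := by
  have h1 := (h.2.1 j (by omega) hjM).2
  have h2 := (h.2.1 (j - 1) (by omega) (by omega)).1
  have hcast : (j : ℝ) * (1 / 2) ≤ ((j - 1 : ℕ) : ℝ) := by
    rw [Nat.cast_sub (by omega)]
    have : (2 : ℝ) ≤ j := by exact_mod_cast hj
    push_cast
    linarith
  have h3 : (j : ℝ) ^ r * (1 / 2) ^ r ≤ ((j - 1 : ℕ) : ℝ) ^ r := by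
    rw [← Real.mul_rpow (by positivity) (by norm_num)]
    exact Real.rpow_le_rpow (by positivity) hcast (by linarith)
  calc _ ≤ c0 / C0 * (1 / 2) ^ r * (C0 * (t 1 * (j : ℝ) ^ r)) := by gcongr
    _ = c0 * (t 1 * ((j : ℝ) ^ r * (1 / 2) ^ r)) := by field_simp
    _ ≤ c0 * (t 1 * ((j - 1 : ℕ) : ℝ) ^ r) := by gcongr
    _ ≤ _ := h2

lemma rpow_mul_rpow_one_sub_le {τ s p q : ℝ} (hτ : 0 < τ) (hτs : τ ≤ s) (hpq : p ≤ q) :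
    τ ^ q * s ^ (1 - q) ≤ τ ^ p * s ^ (1 - p) := by
  have hs : 0 < s := hτ.trans_le hτs
  have e : ∀ p : ℝ, τ ^ p * s ^ (1 - p) = (τ / s) ^ p * s := fun p => by
    rw [Real.rpow_sub hs, Real.rpow_one, Real.div_rpow hτ.le hs.le]
    ring
  rw [e, e]
  refine mul_le_mul_of_nonneg_right ?_ hs.le
  exact Real.rpow_le_rpow_of_exponent_ge (by positivity) ((div_le_one hs).2 hτs) hpq

/-- Stability in the case `γ < α`, to which the general case reduces. -/
lemma stability_of_lt {α r γ T c0 C0 : ℝ} (hα0 : 0 < α) (hα1 : α < 1) (hγ : γ < α)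
    (hr1 : 1 ≤ r) (hr2 : r ≤ (2 - α) / α) (hc0 : 0 < c0) (hcC : c0 ≤ C0) :
    ∃ C : ℝ, 0 < C ∧
      ∀ (M : ℕ) (t : ℕ → ℝ), IsMesh T M t → QuasiGraded r c0 C0 M t →
        ∀ V : ℕ → ℝ, V 0 = 0 →
          (∀ j : ℕ, 1 ≤ j → j ≤ M →
            deltaL1 α t (fun i => |V i|) j ≤ (t 1 / t j) ^ (γ + 1)) →
          ∀ j : ℕ, 1 ≤ j → j ≤ M → |V j| ≤ C * Vcal α γ (t 1) (t j) := by
  have hC0 : 0 < C0 := hc0.trans_le hcC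
  set ρ := c0 / C0 * (1 / 2) ^ r with hρdef
  have hρ : 0 < ρ := by positivity
  have hE : 0 < truncConst α ρ C0 := by
    have : 0 < 1 - α := by linarith
    have : 0 < 2 - α := by linarith
    unfold truncConst
    positivity
  set E := truncConst α ρ C0 with hEdef
  have h1α : 0 < 1 - α := by linarith
  set R := (2 * E / (1 - α)) ^ (1 / α) with hR
  have hRα : R ^ α = 2 * E / (1 - α) := by
    rw [hR, ← Real.rpow_mul (by positivity), one_div_mul_cancel hα0.ne', Real.rpow_one]
  have hR0 : 0 ≤ R := by positivity
  obtain ⟨N, hN⟩ := exists_nat_ge (R / c0)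
  set K₀ := N + 1 with hK₀
  have hK₀R : R ≤ c0 * K₀ := by
    rw [div_le_iff₀ hc0] at hN
    rw [hK₀]
    push_cast
    nlinarith
  set Q := C0 * (K₀ : ℝ) ^ r with hQdef
  have hQ0 : 0 < Q := by positivity
  set c := min (Q ^ (-|γ + 1 - α|)) ((1 - α) / 2) with hc
  have hcpos : 0 < c := lt_min (by positivity) (by linarith)
  have hΓ : 0 < Real.Gamma (1 - α) := Real.Gamma_pos_of_pos h1α
  have hCu : 0 < 1 + (α - γ) / |γ| + Q ^ (-γ) := by
    have : 0 ≤ (α - γ) / |γ| := div_nonneg (by linarith) (abs_nonneg _)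
    positivity
  refine ⟨Real.Gamma (1 - α) / c * (1 + (α - γ) / |γ| + Q ^ (-γ)), by positivity, ?_⟩
  intro M t hM hq V hV0 hV j hj hjM
  obtain ⟨h0, ht⟩ := hM.strictMonoOn
  have hM2 : 2 ≤ M := hM.1
  have hτ : 0 < t 1 := by
    rw [← h0]; exact ht (mem_Iic.2 (by omega)) (mem_Iic.2 (by omega)) one_pos
  have h1le : ∀ i, 1 ≤ i → i ≤ M → t 1 ≤ t i := fun i hi hiM =>
    ht.monotoneOn (mem_Iic.2 (by omega)) (mem_Iic.2 hiM) hi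
  set K := min K₀ M with hK
  have hK1 : 1 ≤ K := le_min (by omega) (by omega)
  have hKM : K ≤ M := min_le_right _ _
  have hQ : t K ≤ Q * t 1 := by
    calc t K ≤ C0 * (t 1 * (K : ℝ) ^ r) := (hq.2.1 K hK1 hKM).2
      _ ≤ C0 * (t 1 * (K₀ : ℝ) ^ r) := by
        have : (K : ℝ) ≤ K₀ := by exact_mod_cast min_le_left K₀ M
        gcongr
      _ = Q * t 1 := by rw [hQdef]; ring
  have hbig : K < M → E * t 1 ^ α ≤ (1 - α) / 2 * t K ^ α := by
    intro hlt
    have hKK : K = K₀ := by omega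
    have h1 : R * t 1 ≤ t K := by
      have h2 := (hq.2.1 K hK1 hKM).1
      rw [hKK] at h2 ⊢
      have h3 : (K₀ : ℝ) ≤ (K₀ : ℝ) ^ r :=
        Real.self_le_rpow_of_one_le (by exact_mod_cast Nat.succ_le_succ (Nat.zero_le N)) hr1
      calc R * t 1 ≤ c0 * (K₀ : ℝ) ^ r * t 1 := by
            refine mul_le_mul_of_nonneg_right (hK₀R.trans ?_) hτ.le
            gcongr
        _ ≤ t K₀ := by linarith
    have h4 : R ^ α * t 1 ^ α ≤ t K ^ α := by
      rw [← Real.mul_rpow hR0 hτ.le]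
      exact Real.rpow_le_rpow (by positivity) h1 hα0.le
    rw [hRα] at h4
    calc E * t 1 ^ α = (1 - α) / 2 * (2 * E / (1 - α) * t 1 ^ α) := by field_simp
      _ ≤ _ := by gcongr
  have hμr : α / (2 - α) ≤ 1 / r := by
    rw [div_le_div_iff₀ (by linarith) (by linarith)]
    rw [le_div_iff₀ hα0] at hr2
    linarith
  have hstep : ∀ i, 1 ≤ i → i ≤ M →
      t i - t (i - 1) ≤ C0 * (t 1 ^ (α / (2 - α)) * t i ^ (1 - α / (2 - α))) := fun i hi hiM =>
    (hq.2.2 i hi hiM).2.trans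
      (mul_le_mul_of_nonneg_left (rpow_mul_rpow_one_sub_le hτ (h1le i hi hiM) hμr) hC0.le)
  have hcmp := le_of_l1Sum_le (V := fun i => |V i|)
    (B := fun i => Real.Gamma (1 - α) / c * barrier α γ t K M i) hα0 hα1 h0 ht
    (by simp [hV0, barrier_zero]) (fun m hm hmM => by
      rw [l1Sum_const_mul]
      have h1 := le_l1Sum_barrier hα0 hα1 hγ h0 ht hK1 hKM hρ hC0
        (fun i hi hiM => hq.ratio hr1 hc0 hC0 hτ hi hiM) hstep hQ hbig hm hmM
      rw [← hc] at h1
      have h2 := hV m hm hmM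
      rw [deltaL1_eq hα1, one_div, inv_mul_le_iff₀ hΓ] at h2
      refine h2.trans ?_
      calc _ = Real.Gamma (1 - α) / c * (c * (t 1 / t m) ^ (γ + 1)) := by field_simp
        _ ≤ _ := by gcongr) j hjM
  refine hcmp.trans ?_
  rw [mul_assoc]
  exact mul_le_mul_of_nonneg_left (barrier_le_Vcal hα0 hα1 hγ h0 ht hK1 hKM hQ hj hjM)
    (by positivity)

/-- Stability of the L1 operator with the hypothesis imposed on `δ_t^α |V^j|`
(Theorem 2.2(iii)). -/
theorem stmt2 (α r γ T c0 C0 : ℝ)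
    (hα0 : 0 < α) (hα1 : α < 1)
    (hr1 : 1 ≤ r) (hr2 : r ≤ (2 - α) / α)
    (hT : 0 < T) (hc0 : 0 < c0) (hcC : c0 ≤ C0) :
    ∃ C : ℝ, 0 < C ∧
      ∀ (M : ℕ) (t : ℕ → ℝ), IsMesh T M t → QuasiGraded r c0 C0 M t →
        ∀ V : ℕ → ℝ, V 0 = 0 →
          (∀ j : ℕ, 1 ≤ j → j ≤ M →
            deltaL1 α t (fun i => |V i|) j ≤ (t 1 / t j) ^ (γ + 1)) →
          ∀ j : ℕ, 1 ≤ j → j ≤ M → |V j| ≤ C * Vcal α γ (t 1) (t j) := by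
  rcases lt_or_ge γ α with hγ | hγ
  · exact stability_of_lt hα0 hα1 hγ hr1 hr2 hc0 hcC
  · obtain ⟨C, hC, h⟩ := stability_of_lt (γ := α / 2) (T := T) hα0 hα1 (by linarith) hr1 hr2 hc0 hcC
    refine ⟨C, hC, fun M t hM hq V hV0 hV j hj hjM => ?_⟩
    obtain ⟨h0, ht⟩ := hM.strictMonoOn
    have hVcal : Vcal α γ (t 1) (t j) = Vcal α (α / 2) (t 1) (t j) := by
      rw [Vcal, Vcal, if_pos (by linarith), if_pos (by linarith)]
    rw [hVcal]
    refine h M t hM hq V hV0 (fun i hi hiM => (hV i hi hiM).trans ?_) j hj hjM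
    have hτ : 0 < t 1 := by
      rw [← h0]; exact ht (mem_Iic.2 (by omega)) (mem_Iic.2 (by omega)) one_pos
    have h1i : t 1 ≤ t i := ht.monotoneOn (mem_Iic.2 (by omega)) (mem_Iic.2 hiM) hi
    have hi0 : 0 < t i := hτ.trans_le h1i
    exact Real.rpow_le_rpow_of_exponent_ge (by positivity) ((div_le_one hi0).2 h1i) (by linarith)
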